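/- Under Assumption B, for every α ∈ ℝⁿ one has I(α) ≤ c_d · c_ψ² · N(α) · ‖f_α‖₁, where c_d = 2(2^d − 1)/(2^{d/2} − 1)². (Lemma 2 of the paper.) -/

import Mathlib

open MeasureTheory Finset
open scoped symmDiff

noncomputable section

/-- The unit cube `[0,1]^d ⊂ ℝ^d`. -/
def cube (d : ℕ) : Set (Fin d → ℝ) := Set.univ.pi fun _ => Set.Icc (0:ℝ) 1

/-- The unit cube `[0,1]^{d+1} = [0,1]^d × [0,1]`. -/
def cubeP (d : ℕ) : Set ((Fin d → ℝ) × ℝ) := (cube d) ×ˢ Set.Icc (0:ℝ) 1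

/-- `√I(α) = Σ_{l=1}^L 2^{dl/4} √(Σ_{j∈I_l} |α_{j,l}|)`; level `l : Fin L` represents level `l+1`. -/
def sqrtNS {L n : ℕ} (d : ℕ) (I : Fin L → Finset (Fin n)) (α : Fin n → ℝ) : ℝ :=
  ∑ l : Fin L, (2:ℝ) ^ (((d * (l.1 + 1) : ℕ) : ℝ) / 4) * Real.sqrt (∑ j ∈ I l, |α j|)

/-- The nonsparsity measure `I(α)`. -/
def NS {L n : ℕ} (d : ℕ) (I : Fin L → Finset (Fin n)) (α : Fin n → ℝ) : ℝ := (sqrtNS d I α) ^ 2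

/-- `f_α = Σ_{l} Σ_{j∈I_l} α_{j,l} ψ_{j,l}`. -/
def fExp {d L n : ℕ} (I : Fin L → Finset (Fin n)) (ψ : Fin n → (Fin d → ℝ) → ℝ)
    (α : Fin n → ℝ) : (Fin d → ℝ) → ℝ :=
  fun s => ∑ l : Fin L, ∑ j ∈ I l, α j * ψ j s

/-- The boundary fragment `G_f = {(s,t) ∈ [0,1]^d × [0,1] : f(s) ≥ t}`. -/
def fragment {d : ℕ} (f : (Fin d → ℝ) → ℝ) : Set ((Fin d → ℝ) × ℝ) :=
  {p | p.1 ∈ cube d ∧ p.2 ∈ Set.Icc (0:ℝ) 1 ∧ p.2 ≤ f p.1}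

/-- Assumption B of the paper: `{ψ_{j,l}}` is an orthonormal wavelet-type system. -/
structure AssumpB (d L n : ℕ) (I : Fin L → Finset (Fin n))
    (ψ : Fin n → (Fin d → ℝ) → ℝ) (cψ : ℝ) : Prop where
  one_le : 1 ≤ cψ
  meas : ∀ k, Measurable (ψ k)
  orthonormal : ∀ j k, (∫ s in cube d, ψ j s * ψ k s) = if j = k then 1 else 0
  l1_bound : ∀ l : Fin L, ∀ j ∈ I l,
    (∫ s in cube d, |ψ j s|) ≤ cψ * (2:ℝ) ^ (-(((d * (l.1 + 1) : ℕ) : ℝ) / 2))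
  sup_bound : ∀ l : Fin L, ∀ s ∈ cube d,
    (∑ j ∈ I l, |ψ j s|) ≤ cψ * (2:ℝ) ^ ((((d * (l.1 + 1) : ℕ) : ℝ)) / 2)
  card_lower : ∀ l : Fin L, (2:ℝ) ^ (d * (l.1 + 1)) / cψ ≤ ((I l).card : ℝ)
  card_upper : ∀ l : Fin L, ((I l).card : ℝ) ≤ cψ * (2:ℝ) ^ (d * (l.1 + 1))
  levels : (L : ℝ) ≤ cψ * Real.log n / d
  disj : ∀ l l' : Fin L, l ≠ l' → Disjoint (I l) (I l')
  total : ∑ l : Fin L, (I l).card = n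

/-- `N_m = Σ_{l=1}^m |I_l|`. -/
def Nm {L n : ℕ} (I : Fin L → Finset (Fin n)) (m : ℕ) : ℕ :=
  ∑ l ∈ Finset.univ.filter (fun l : Fin L => l.1 + 1 ≤ m), (I l).card

/-- `m(α) = min{m : α_{j,l} = 0 for all j ∈ I_l with l > m}`. -/
def mlev {L n : ℕ} (I : Fin L → Finset (Fin n)) (α : Fin n → ℝ) : ℕ :=
  sInf {m | ∀ l : Fin L, m < l.1 + 1 → ∀ j ∈ I l, α j = 0}

/-- `N(α) = N_{m(α)}`. -/
def Nlev {L n : ℕ} (I : Fin L → Finset (Fin n)) (α : Fin n → ℝ) : ℕ := Nm I (mlev I α)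

lemma measurableSet_cube (d : ℕ) : MeasurableSet (cube d) :=
  MeasurableSet.univ_pi fun _ => measurableSet_Icc

instance isFiniteMeasure_restrict_cube (d : ℕ) :
    IsFiniteMeasure (volume.restrict (cube d)) :=
  isFiniteMeasure_restrict.mpr
    (isCompact_univ_pi fun _ : Fin d => isCompact_Icc (a := (0:ℝ)) (b := 1)).measure_lt_top.ne

namespace AssumpB

variable {d L n : ℕ} {I : Fin L → Finset (Fin n)} {ψ : Fin n → (Fin d → ℝ) → ℝ} {cψ : ℝ}

lemma exists_bound (hB : AssumpB d L n I ψ cψ) {l : Fin L} {j : Fin n} (hj : j ∈ I l) :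
    ∃ C, ∀ s ∈ cube d, |ψ j s| ≤ C :=
  ⟨_, fun s hs => (single_le_sum (f := fun j => |ψ j s|) (fun _ _ => abs_nonneg _) hj).trans
    (hB.sup_bound l s hs)⟩

lemma integrableOn (hB : AssumpB d L n I ψ cψ) {l : Fin L} {j : Fin n} (hj : j ∈ I l) :
    IntegrableOn (ψ j) (cube d) := by
  obtain ⟨C, hC⟩ := hB.exists_bound hj
  refine Integrable.of_bound (hB.meas j).aestronglyMeasurable C ?_
  filter_upwards [ae_restrict_mem (measurableSet_cube d)] with s hs using hC s hs

lemma integrableOn_mul (hB : AssumpB d L n I ψ cψ) {l : Fin L} {j : Fin n} (hj : j ∈ I l)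
    {g : (Fin d → ℝ) → ℝ} (hg : IntegrableOn g (cube d)) :
    IntegrableOn (fun s => g s * ψ j s) (cube d) := by
  obtain ⟨C, hC⟩ := hB.exists_bound hj
  refine Integrable.mul_bdd (c := C) hg (hB.meas j).aestronglyMeasurable ?_
  filter_upwards [ae_restrict_mem (measurableSet_cube d)] with s hs using hC s hs

lemma integrableOn_fExp (hB : AssumpB d L n I ψ cψ) (α : Fin n → ℝ) :
    IntegrableOn (fExp I ψ α) (cube d) :=
  integrable_finsetSum _ fun _ _ => integrable_finsetSum _ fun j hj =>
    (hB.integrableOn hj).const_mul (α j)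

/-- The coefficients of `fExp I ψ α` are recovered by integration against `ψ`. -/
lemma integral_fExp_mul (hB : AssumpB d L n I ψ cψ) (α : Fin n → ℝ) {l : Fin L} {j : Fin n}
    (hj : j ∈ I l) : ∫ s in cube d, fExp I ψ α s * ψ j s = α j := by
  have h_integrable : ∀ l' : Fin L, ∀ k ∈ I l',
      IntegrableOn (fun s => α k * (ψ k s * ψ j s)) (cube d) := fun l' k hk =>
    (hB.integrableOn_mul hj (hB.integrableOn hk)).const_mul (α k)
  have hcongr : ∀ s, fExp I ψ α s * ψ j s =
      ∑ l' : Fin L, ∑ k ∈ I l', α k * (ψ k s * ψ j s) := fun s => by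
    simp only [fExp, sum_mul, mul_assoc]
  simp_rw [hcongr]
  rw [integral_finsetSum _ fun l' _ => integrable_finsetSum _ (h_integrable l')]
  have hlev : ∀ l' : Fin L, ∫ s in cube d, ∑ k ∈ I l', α k * (ψ k s * ψ j s) =
      if j ∈ I l' then α j else 0 := fun l' => by
    rw [integral_finsetSum _ (h_integrable l')]
    simp [integral_const_mul, hB.orthonormal]
  simp_rw [hlev]
  rw [sum_eq_single l]
  · simp [hj]
  · intro l' _ hne
    exact if_neg fun h => disjoint_left.mp (hB.disj l' l hne) h hj
  · simp

lemma sum_abs_coeff_le (hB : AssumpB d L n I ψ cψ) (α : Fin n → ℝ) (l : Fin L) :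
    ∑ j ∈ I l, |α j| ≤
      (∫ s in cube d, |fExp I ψ α s|) * (cψ * (2:ℝ) ^ (((d * (l.1 + 1) : ℕ) : ℝ) / 2)) := by
  have hf := hB.integrableOn_fExp α
  have h_integrable : ∀ j ∈ I l, IntegrableOn (fun s => |fExp I ψ α s * ψ j s|) (cube d) :=
    fun j hj => (hB.integrableOn_mul hj hf).abs
  calc ∑ j ∈ I l, |α j|
      ≤ ∑ j ∈ I l, ∫ s in cube d, |fExp I ψ α s * ψ j s| := by
        refine sum_le_sum fun j hj => ?_
        rw [← hB.integral_fExp_mul α hj]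
        exact abs_integral_le_integral_abs
    _ = ∫ s in cube d, ∑ j ∈ I l, |fExp I ψ α s * ψ j s| :=
        (integral_finsetSum _ h_integrable).symm
    _ ≤ ∫ s in cube d, |fExp I ψ α s| * (cψ * (2:ℝ) ^ (((d * (l.1 + 1) : ℕ) : ℝ) / 2)) := by
        refine setIntegral_mono_on (integrable_finsetSum _ h_integrable) (hf.abs.mul_const _)
          (measurableSet_cube d) fun s hs => ?_
        simp_rw [abs_mul, ← mul_sum]
        exact mul_le_mul_of_nonneg_left (hB.sup_bound l s hs) (abs_nonneg _)
    _ = _ := integral_mul_const _ _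

end AssumpB

lemma mlev_le {L n : ℕ} (I : Fin L → Finset (Fin n)) (α : Fin n → ℝ) : mlev I α ≤ L :=
  Nat.sInf_le fun l hl => absurd hl (by have := l.2; omega)

lemma eq_zero_of_mlev_lt {L n : ℕ} (I : Fin L → Finset (Fin n)) (α : Fin n → ℝ) (l : Fin L)
    (hl : mlev I α < l.1 + 1) : ∀ j ∈ I l, α j = 0 :=
  Nat.sInf_mem (s := {m | ∀ l : Fin L, m < l.1 + 1 → ∀ j ∈ I l, α j = 0})
    ⟨L, fun l hl => absurd hl (by have := l.2; omega)⟩ l hl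

lemma sum_fin_filter_eq_sum_range {L m : ℕ} (hm : m ≤ L) (g : ℕ → ℝ) :
    ∑ l ∈ Finset.univ.filter (fun l : Fin L => l.1 + 1 ≤ m), g l.1 = ∑ i ∈ range m, g i := by
  rw [sum_filter, Fin.sum_univ_eq_sum_range (fun i => if i + 1 ≤ m then g i else 0),
    ← sum_filter]
  congr 1
  ext i
  simp only [mem_filter, mem_range]
  omega

lemma sq_sum_pow_succ_le {q : ℝ} (hq : 1 < q) (m : ℕ) :
    (∑ i ∈ range m, q ^ (i + 1)) ^ 2 ≤
      2 * (q ^ 2 - 1) / (q - 1) ^ 2 * ∑ i ∈ range m, (q ^ 2) ^ (i + 1) := by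
  have h1 : (∑ i ∈ range m, q ^ (i + 1)) * (q - 1) = q * (q ^ m - 1) := by
    simp_rw [pow_succ', ← mul_sum]
    rw [mul_assoc, geom_sum_mul]
  have h2 : (∑ i ∈ range m, (q ^ 2) ^ (i + 1)) * (q ^ 2 - 1) =
      q ^ 2 * ((q ^ m) ^ 2 - 1) := by
    simp_rw [pow_succ' (q ^ 2), ← mul_sum]
    rw [mul_assoc, geom_sum_mul, pow_right_comm]
  have hx : 1 ≤ q ^ m := one_le_pow₀ hq.le
  rw [div_mul_eq_mul_div, le_div_iff₀ (by have := sub_pos.mpr hq; positivity), ← mul_pow, h1]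
  calc (q * (q ^ m - 1)) ^ 2 ≤ 2 * (q ^ 2 * ((q ^ m) ^ 2 - 1)) := by
        nlinarith [mul_nonneg (sq_nonneg q)
          (mul_nonneg (sub_nonneg.mpr hx) (by linarith : (0:ℝ) ≤ q ^ m + 3))]
    _ = _ := by rw [← h2]; ring

lemma AssumpB.sqrtNS_le {d L n : ℕ} {I : Fin L → Finset (Fin n)} {ψ : Fin n → (Fin d → ℝ) → ℝ}
    {cψ : ℝ} (hB : AssumpB d L n I ψ cψ) (α : Fin n → ℝ) :
    sqrtNS d I α ≤ √(cψ * ∫ s in cube d, |fExp I ψ α s|) *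
      ∑ i ∈ range (mlev I α), ((2:ℝ) ^ ((d:ℝ) / 2)) ^ (i + 1) := by
  have hF : 0 ≤ cψ * ∫ s in cube d, |fExp I ψ α s| :=
    mul_nonneg (zero_le_one.trans hB.one_le) (integral_nonneg fun _ => abs_nonneg _)
  rw [← sum_fin_filter_eq_sum_range (mlev_le I α), mul_sum, sqrtNS, sum_filter]
  refine sum_le_sum fun l _ => ?_
  split_ifs with hl
  · set x : ℝ := (2:ℝ) ^ (((d * (l.1 + 1) : ℕ) : ℝ) / 4) with hx
    have hx0 : 0 ≤ x := by positivity
    have hxx : (2:ℝ) ^ (((d * (l.1 + 1) : ℕ) : ℝ) / 2) = x ^ 2 := by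
      rw [hx, ← Real.rpow_mul_natCast (by norm_num)]
      congr 1
      push_cast
      ring
    have hq : ((2:ℝ) ^ ((d:ℝ) / 2)) ^ (l.1 + 1) = x ^ 2 := by
      rw [← hxx, ← Real.rpow_mul_natCast (by norm_num)]
      congr 1
      push_cast
      ring
    have hS := hB.sum_abs_coeff_le α l
    rw [hxx] at hS
    calc x * √(∑ j ∈ I l, |α j|)
        ≤ x * √((cψ * ∫ s in cube d, |fExp I ψ α s|) * x ^ 2) := by
          gcongr
          linarith
      _ = _ := by rw [Real.sqrt_mul hF, Real.sqrt_sq hx0, hq]; ring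
  · have hz : ∑ j ∈ I l, |α j| = 0 := sum_eq_zero fun j hj => by
      rw [eq_zero_of_mlev_lt I α l (not_le.mp hl) j hj, abs_zero]
    simp [hz]

lemma AssumpB.sum_pow_le_Nlev {d L n : ℕ} {I : Fin L → Finset (Fin n)}
    {ψ : Fin n → (Fin d → ℝ) → ℝ} {cψ : ℝ} (hB : AssumpB d L n I ψ cψ) (α : Fin n → ℝ) :
    ∑ i ∈ range (mlev I α), ((2:ℝ) ^ d) ^ (i + 1) ≤ cψ * (Nlev I α : ℝ) := by
  rw [← sum_fin_filter_eq_sum_range (mlev_le I α), Nlev, Nm, Nat.cast_sum, mul_sum]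
  refine sum_le_sum fun l _ => ?_
  rw [← pow_mul]
  have := hB.card_lower l
  rwa [div_le_iff₀' (zero_lt_one.trans_le hB.one_le)] at this

/-- Lemma 2: under Assumption B, `I(α) ≤ c_d c_ψ² N(α) ‖f_α‖₁` with
`c_d = 2(2^d − 1)/(2^{d/2} − 1)²`. -/
theorem lemma2_NS_le {d L n : ℕ} (hd : 0 < d) (hL : 0 < L) (hn : 0 < n)
    (I : Fin L → Finset (Fin n)) (ψ : Fin n → (Fin d → ℝ) → ℝ) (cψ : ℝ)
    (hB : AssumpB d L n I ψ cψ) (α : Fin n → ℝ) :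
    NS d I α ≤ (2 * ((2:ℝ) ^ d - 1) / ((2:ℝ) ^ ((d : ℝ) / 2) - 1) ^ 2) * cψ ^ 2 *
      (Nlev I α : ℝ) * (∫ s in cube d, |fExp I ψ α s|) := by
  set F : ℝ := ∫ s in cube d, |fExp I ψ α s|
  have hc : 0 ≤ cψ := zero_le_one.trans hB.one_le
  have hF : 0 ≤ F := integral_nonneg fun _ => abs_nonneg _
  have hS := hB.sqrtNS_le α
  have hN := hB.sum_pow_le_Nlev α
  have hq1 : 1 < (2:ℝ) ^ ((d:ℝ) / 2) := Real.one_lt_rpow (by norm_num) (by positivity)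
  have hq2 : (2:ℝ) ^ d = ((2:ℝ) ^ ((d:ℝ) / 2)) ^ 2 := by
    rw [← Real.rpow_mul_natCast (by norm_num), ← Real.rpow_natCast]
    congr 1
    push_cast
    ring
  rw [hq2] at hN ⊢
  set q : ℝ := (2:ℝ) ^ ((d:ℝ) / 2)
  have h0 : 0 ≤ sqrtNS d I α := sum_nonneg fun _ _ => by positivity
  have hK : 0 ≤ 2 * (q ^ 2 - 1) / (q - 1) ^ 2 :=
    div_nonneg (by nlinarith) (sq_nonneg _)
  calc NS d I α
      ≤ (√(cψ * F) * ∑ i ∈ range (mlev I α), q ^ (i + 1)) ^ 2 := pow_le_pow_left₀ h0 hS 2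
    _ = cψ * F * (∑ i ∈ range (mlev I α), q ^ (i + 1)) ^ 2 := by
        rw [mul_pow, Real.sq_sqrt (mul_nonneg hc hF)]
    _ ≤ cψ * F * (2 * (q ^ 2 - 1) / (q - 1) ^ 2 * (cψ * (Nlev I α : ℝ))) := by
        refine mul_le_mul_of_nonneg_left ?_ (mul_nonneg hc hF)
        exact (sq_sum_pow_succ_le hq1 _).trans (mul_le_mul_of_nonneg_left hN hK)
    _ = _ := by ring
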